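/- Let H be a graph with at least 3 edges, and let γ₀(H) be the minimum of (h'−2)/(f'−1) over all subgraphs H' of H with h' vertices and f' ≥ 3 edges. There exists a constant c > 0, depending only on H, such that for every integer n ≥ 2 and every finite field F, there exists a graph G on n vertices whose complement is H-free and which satisfies minrk_F(G) ≥ c · n^{1−γ₀(H)} / log(n · |F|). -/

import Mathlib

open Matrix

/-- `M` represents the graph `G` over a field: nonzero diagonal entries, and zero entries at
off-diagonal non-adjacent pairs. -/
def Represents {F V : Type*} [Field F] (M : Matrix V V F) (G : SimpleGraph V) : Prop :=
  (∀ v, M v v ≠ 0) ∧ ∀ u v, u ≠ v → ¬ G.Adj u v → M u v = 0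

/-- The minrank of a graph `G` over a field `F`: the minimum possible rank of a matrix
representing `G`. -/
noncomputable def minrk (F : Type*) [Field F] {V : Type*} [Fintype V]
    (G : SimpleGraph V) : ℕ :=
  sInf { r : ℕ | ∃ M : Matrix V V F, Represents M G ∧ M.rank = r }

/-- `G` contains a copy of `H` as a (not necessarily induced) subgraph, i.e. there is an
injective graph homomorphism from `H` to `G`. -/
def ContainsCopy {V W : Type*} (H : SimpleGraph W) (G : SimpleGraph V) : Prop :=
  ∃ f : W → V, Function.Injective f ∧ ∀ a b, H.Adj a b → G.Adj (f a) (f b)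
/-- γ₀(H): the minimum of (h'-2)/(f'-1) over all subgraphs H' of H with f' ≥ 3 edges,
where h' is the number of vertices of H' and f' its number of edges. -/
noncomputable def gamma0 {h : ℕ} (H : SimpleGraph (Fin h)) : ℝ :=
  sInf { x : ℝ | ∃ H' : SimpleGraph.Subgraph H, 3 ≤ H'.edgeSet.ncard ∧
    x = ((H'.verts.ncard : ℝ) - 2) / ((H'.edgeSet.ncard : ℝ) - 1) }

open Finset in
/-- A greedy choice of a light spanning subfamily. -/
lemma exists_light_spanning_subset {K E ι : Type*} [Field K] [AddCommGroup E] [Module K E]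
    [FiniteDimensional K E] [DecidableEq ι] (v : ι → E) (w : ι → ℝ) (hw : ∀ i, 0 ≤ w i) (α : ℝ)
    (A : Finset ι)
    (hA : ∀ B ⊆ A, α * #B ≤ Module.finrank K (Submodule.span K (v '' (B : Set ι)))) :
    ∃ J ⊆ A, Submodule.span K (v '' (J : Set ι)) = Submodule.span K (v '' (A : Set ι)) ∧
      ∀ W, (∀ a ∈ A, w a ≤ W) → ∑ j ∈ J, w j ≤ α * ∑ a ∈ A, w a +
        (Module.finrank K (Submodule.span K (v '' (A : Set ι))) - α * #A) * W := by
  induction A using Finset.induction_on_max_value w with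
  | empty =>
    refine ⟨∅, subset_rfl, rfl, fun W _ => ?_⟩
    rw [coe_empty, Set.image_empty, Submodule.span_empty, finrank_bot]
    simp
  | insert a s has hmax ih =>
    obtain ⟨J, hJs, hspan, hJ⟩ := ih fun B hB => hA B (hB.trans (subset_insert _ _))
    have hJ := hJ (w a) hmax
    have hr := hA _ subset_rfl
    rw [card_insert_of_notMem has] at hr
    push_cast at hr
    by_cases hmem : v a ∈ Submodule.span K (v '' (s : Set ι))
    · have heq : Submodule.span K (v '' ((insert a s : Finset ι) : Set ι)) =
          Submodule.span K (v '' (s : Set ι)) := by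
        rw [coe_insert, Set.image_insert_eq, Submodule.span_insert_eq_span hmem]
      refine ⟨J, hJs.trans (subset_insert _ _), by rw [heq, hspan], fun W hW => ?_⟩
      rw [heq] at hr ⊢
      rw [card_insert_of_notMem has, sum_insert has]
      push_cast
      nlinarith [hW a (mem_insert_self _ _)]
    · have hlt : Submodule.span K (v '' (s : Set ι)) <
          Submodule.span K (v '' ((insert a s : Finset ι) : Set ι)) := by
        refine lt_of_le_of_ne (Submodule.span_mono (Set.image_mono (by simp))) fun h => hmem ?_
        rw [h]
        exact Submodule.subset_span ⟨a, by simp, rfl⟩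
      have hlt' : (Module.finrank K (Submodule.span K (v '' (s : Set ι))) : ℝ) + 1 ≤
          Module.finrank K (Submodule.span K (v '' ((insert a s : Finset ι) : Set ι))) := by
        exact_mod_cast Submodule.finrank_lt_finrank_of_lt hlt
      refine ⟨insert a J, insert_subset_insert _ hJs, ?_, fun W hW => ?_⟩
      · simp only [coe_insert, Set.image_insert_eq, Submodule.span_insert, hspan]
      · rw [card_insert_of_notMem has, sum_insert has, sum_insert (fun h => has (hJs h))]
        push_cast
        nlinarith [hW a (mem_insert_self _ _), hw a]

/-- The number of nonzero entries of a matrix. -/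
noncomputable def numNonzero {F V : Type*} [Field F] [Fintype V] (M : Matrix V V F) : ℕ := by
  classical exact (Finset.univ.filter fun x : V × V => M x.1 x.2 ≠ 0).card

/-- The diagonal matrix projecting onto the coordinates in `A`. -/
def coordProj (F : Type*) {V : Type*} [Field F] [DecidableEq V] (A : Finset V) : Matrix V V F :=
  Matrix.diagonal fun v => if v ∈ A then 1 else 0

lemma numNonzero_transpose {F V : Type*} [Field F] [Fintype V] (M : Matrix V V F) : numNonzero Mᵀ = numNonzero M := by
  classical
  unfold numNonzero
  refine Finset.card_equiv (Equiv.prodComm V V) fun x => ?_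
  rw [Finset.mem_filter, Finset.mem_filter]
  simp

lemma transpose_coordProj {F V : Type*} [Field F] [DecidableEq V] (A : Finset V) :
    (coordProj F A)ᵀ = coordProj F A := by
  simp [coordProj]

section Structure

variable {F V : Type*} [Field F] [Fintype V] [DecidableEq V]

lemma coordProj_mul_coordProj (A B : Finset V) :
    coordProj F A * coordProj F B = coordProj F (A ∩ B) := by
  simp only [coordProj, Matrix.diagonal_mul_diagonal]
  congr 1
  ext v
  by_cases h : v ∈ A <;> by_cases h' : v ∈ B <;> simp [h, h']

lemma mul_coordProj_apply (M : Matrix V V F) (A : Finset V) (i j : V) :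
    (M * coordProj F A) i j = if j ∈ A then M i j else 0 := by
  simp [coordProj, Matrix.mul_diagonal]

lemma coordProj_mul_apply (M : Matrix V V F) (A : Finset V) (i j : V) :
    (coordProj F A * M) i j = if i ∈ A then M i j else 0 := by
  simp [coordProj, Matrix.diagonal_mul]

open Finset in
lemma numNonzero_mul_coordProj [DecidableEq F] (M : Matrix V V F) (J : Finset V) :
    numNonzero (M * coordProj F J) = ∑ j ∈ J, #{i | M i j ≠ 0} := by
  classical
  unfold numNonzero
  simp only [mul_coordProj_apply]
  rw [card_eq_sum_card_fiberwise (f := Prod.snd) (t := J) (fun x hx => by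
    by_contra h
    simp_all)]
  refine sum_congr rfl fun j hj => ?_
  refine card_bij (fun x _ => x.1) (fun x hx => ?_) (fun x hx y hy h => ?_) fun i hi => ?_
  · simp only [mem_filter, mem_univ, true_and] at hx ⊢
    simpa [hx.2, hj] using hx.1
  · simp only [mem_filter] at hx hy
    exact Prod.ext h (hx.2.trans hy.2.symm)
  · exact ⟨(i, j), by simpa [hj] using hi, rfl⟩

open Finset in
/-- If the principal submatrix on `A` has minimal relative rank then it has a sparse column
basis. -/
lemma exists_sparse_column_basis (M : Matrix V V F) (A : Finset V) (hA : A.Nonempty)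
    (hmin : ∀ B : Finset V, B.Nonempty →
      ((coordProj F A * M * coordProj F A).rank : ℝ) / #A ≤
        ((coordProj F B * M * coordProj F B).rank : ℝ) / #B) :
    ∃ J : Finset V,
      (∃ Q, coordProj F A * M * coordProj F A =
        coordProj F A * M * coordProj F A * coordProj F J * Q) ∧
      (numNonzero (coordProj F A * M * coordProj F A * coordProj F J) : ℝ) ≤
        ((coordProj F A * M * coordProj F A).rank : ℝ) / #A *
          numNonzero (coordProj F A * M * coordProj F A) := by
  classical
  set N := coordProj F A * M * coordProj F A with hN
  set α : ℝ := (N.rank : ℝ) / #A with hα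
  have hAc : (0 : ℝ) < #A := by exact_mod_cast hA.card_pos
  have hcol : ∀ B ⊆ A, α * #B ≤ Module.finrank F (Submodule.span F (N.col '' (B : Set V))) := by
    intro B hB
    rcases B.eq_empty_or_nonempty with rfl | hBne
    · simp
    have hBc : (0 : ℝ) < #B := by exact_mod_cast hBne.card_pos
    have h1 := hmin B hBne
    rw [le_div_iff₀ hBc] at h1
    refine h1.trans ?_
    have h2 : coordProj F B * M * coordProj F B = coordProj F B * (N * coordProj F B) := by
      rw [hN]
      simp only [Matrix.mul_assoc]
      rw [coordProj_mul_coordProj, ← Matrix.mul_assoc, ← Matrix.mul_assoc (coordProj F B),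
        coordProj_mul_coordProj, inter_eq_left.2 hB, inter_eq_right.2 hB, Matrix.mul_assoc]
    rw [h2]
    norm_cast
    refine (Matrix.rank_mul_le_right _ _).trans ?_
    rw [Matrix.rank_eq_finrank_span_cols]
    refine Submodule.finrank_mono (Submodule.span_le.2 ?_)
    rintro _ ⟨j, rfl⟩
    by_cases hj : j ∈ B
    · refine Submodule.subset_span ⟨j, hj, ?_⟩
      ext i
      simp [Matrix.col, mul_coordProj_apply, hj]
    · have h0 : (N * coordProj F B).col j = 0 := by
        ext i
        simp [Matrix.col, mul_coordProj_apply, hj]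
      rw [h0]
      exact Submodule.zero_mem _
  obtain ⟨J, hJA, hspan, hJ⟩ := exists_light_spanning_subset N.col
    (fun j => (#{i | N i j ≠ 0} : ℝ)) (fun _ => by positivity) α A hcol
  have hNA : N * coordProj F A = N := by
    rw [hN, Matrix.mul_assoc, coordProj_mul_coordProj, inter_self]
  refine ⟨J, ?_, ?_⟩
  · have hmem : ∀ j, ∃ q : V → F, (N * coordProj F J).mulVec q = N.col j := by
      intro j
      have : N.col j ∈ Submodule.span F (N.col '' (J : Set V)) := by
        rw [hspan]
        by_cases hj : j ∈ A
        · exact Submodule.subset_span ⟨j, hj, rfl⟩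
        · convert Submodule.zero_mem _ using 1
          ext i
          rw [← hNA]
          simp [Matrix.col, mul_coordProj_apply, hj]
      have h2 : Submodule.span F (N.col '' (J : Set V)) ≤
          LinearMap.range (N * coordProj F J).mulVecLin := by
        rw [Matrix.range_mulVecLin]
        refine Submodule.span_mono ?_
        rintro _ ⟨j, hj, rfl⟩
        refine ⟨j, ?_⟩
        ext i
        have hj : j ∈ J := hj
        simp [Matrix.col, mul_coordProj_apply, hj]
      obtain ⟨q, hq⟩ := h2 this
      exact ⟨q, hq⟩
    choose q hq using hmem
    refine ⟨(Matrix.of q)ᵀ, ?_⟩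
    ext i j
    have := congrFun (hq j) i
    simp only [Matrix.col] at this
    rw [Matrix.mul_apply]
    simpa [Matrix.mulVec, dotProduct] using this.symm
  · obtain ⟨W, hW⟩ : ∃ W : ℝ, ∀ a ∈ A, (#{i | N i a ≠ 0} : ℝ) ≤ W :=
      ⟨Fintype.card V, fun a _ => by exact_mod_cast card_le_univ _⟩
    have hW0 : 0 ≤ W := by
      obtain ⟨a, ha⟩ := hA
      exact le_trans (by positivity) (hW a ha)
    have h3 := hJ W hW
    have h4 : (Module.finrank F (Submodule.span F (N.col '' (A : Set V))) : ℝ) ≤ α * #A := by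
      rw [hα, div_mul_cancel₀ _ hAc.ne', Matrix.rank_eq_finrank_span_cols]
      norm_cast
      exact Submodule.finrank_mono (Submodule.span_mono (Set.image_subset_range _ _))
    rw [numNonzero_mul_coordProj]
    have h5 : (numNonzero N : ℝ) = ∑ a ∈ A, (#{i | N i a ≠ 0} : ℝ) := by
      conv_lhs => rw [← hNA, numNonzero_mul_coordProj]
      push_cast
      rfl
    rw [h5]
    push_cast
    nlinarith

open Finset in
/-- Every matrix with nonzero diagonal has a principal submatrix of no larger relative rank,
in which some row basis and some column basis are no denser than average. -/
lemma exists_sparse_bases [Nonempty V] (M : Matrix V V F) (hM : ∀ v, M v v ≠ 0) :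
    ∃ A I J : Finset V, ∃ N : Matrix V V F, A.Nonempty ∧
      N = coordProj F A * M * coordProj F A ∧
      (∃ P, N = P * (coordProj F I * N)) ∧ (∃ Q, N = N * coordProj F J * Q) ∧
      (numNonzero (coordProj F I * N) : ℝ) ≤ M.rank / Fintype.card V * numNonzero N ∧
      (numNonzero (N * coordProj F J) : ℝ) ≤ M.rank / Fintype.card V * numNonzero N ∧
      #A ≤ numNonzero (coordProj F I * N) := by
  classical
  obtain ⟨A, hA, hmin⟩ := (univ.filter fun A : Finset V => A.Nonempty).exists_min_image
    (fun A => ((coordProj F A * M * coordProj F A).rank : ℝ) / #A)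
    ⟨univ, by simp⟩
  simp only [mem_filter, mem_univ, true_and] at hA hmin
  have hT : ∀ B : Finset V, coordProj F B * Mᵀ * coordProj F B =
      (coordProj F B * M * coordProj F B)ᵀ := fun B => by
    simp [Matrix.transpose_mul, transpose_coordProj, Matrix.mul_assoc]
  have hα : ((coordProj F A * M * coordProj F A).rank : ℝ) / #A ≤ M.rank / Fintype.card V := by
    have := hmin univ univ_nonempty
    simpa [coordProj] using this
  obtain ⟨J, ⟨Q, hQ⟩, hJ⟩ := exists_sparse_column_basis M A hA hmin
  obtain ⟨I, ⟨P, hP⟩, hI⟩ := exists_sparse_column_basis Mᵀ A hA (by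
    simpa only [hT, Matrix.rank_transpose] using hmin)
  rw [hT] at hP hI
  obtain ⟨N, hN⟩ : ∃ N, N = coordProj F A * M * coordProj F A := ⟨_, rfl⟩
  rw [← hN] at hα hQ hJ hP hI
  have hNI : Nᵀ * coordProj F I = (coordProj F I * N)ᵀ := by
    rw [Matrix.transpose_mul, transpose_coordProj]
  rw [hNI] at hP hI
  rw [numNonzero_transpose, numNonzero_transpose, Matrix.rank_transpose] at hI
  have hP' : N = Pᵀ * (coordProj F I * N) := by
    have := congrArg Matrix.transpose hP
    rwa [Matrix.transpose_mul, Matrix.transpose_transpose, Matrix.transpose_transpose] at this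
  refine ⟨A, I, J, N, hA, hN, ⟨Pᵀ, hP'⟩, ⟨Q, hQ⟩, hI.trans (by gcongr), hJ.trans (by gcongr), ?_⟩
  have hex : ∀ a ∈ A, ∃ i, (coordProj F I * N) i a ≠ 0 := by
    intro a ha
    by_contra! h
    have h1 : N a a ≠ 0 := by
      rw [hN, mul_coordProj_apply, coordProj_mul_apply]
      simpa [ha] using hM a
    rw [hP', Matrix.mul_apply] at h1
    simp [h] at h1
  choose! g hg using hex
  refine card_le_card_of_injOn (fun a => (g a, a)) (fun a ha => ?_) fun a _ b _ h => ?_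
  · simpa using hg a ha
  · exact (Prod.ext_iff.1 h).2

/-- A matrix is determined by a row basis and a column basis. -/
lemma eq_of_bases_eq {N₁ N₂ P₁ P₂ Q₁ X Y : Matrix V V F} {I₁ J₁ J₂ : Finset V}
    (hX₁ : X = coordProj F I₁ * N₁) (hY₁ : Y = N₁ * coordProj F J₁)
    (hY₂ : Y = N₂ * coordProj F J₂) (hP₁ : N₁ = P₁ * X) (hP₂ : N₂ = P₂ * X)
    (hQ₁ : N₁ = Y * Q₁) : N₁ = N₂ := by
  have hYJ₁ : Y * coordProj F J₁ = Y := by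
    rw [hY₁, Matrix.mul_assoc, coordProj_mul_coordProj, Finset.inter_self]
  have hYJ₂ : Y * coordProj F J₂ = Y := by
    rw [hY₂, Matrix.mul_assoc, coordProj_mul_coordProj, Finset.inter_self]
  have hXJ : X * coordProj F J₁ * coordProj F J₂ = coordProj F I₁ * Y := by
    rw [hX₁, Matrix.mul_assoc, Matrix.mul_assoc, ← Matrix.mul_assoc N₁, ← hY₁, hYJ₂]
  have h₁ : P₁ * (coordProj F I₁ * Y) = Y := by
    rw [← hXJ, ← Matrix.mul_assoc, ← Matrix.mul_assoc, ← hP₁, ← hY₁, hYJ₂]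
  have h₂ : P₂ * (coordProj F I₁ * Y) = Y := by
    rw [← hXJ, Matrix.mul_assoc X, coordProj_mul_coordProj, Finset.inter_comm,
      ← coordProj_mul_coordProj, ← Matrix.mul_assoc, ← Matrix.mul_assoc, ← hP₂, ← hY₂, hYJ₁]
  have hXY : X = coordProj F I₁ * Y * Q₁ := by rw [Matrix.mul_assoc, ← hQ₁, hX₁]
  rw [hP₁, hP₂, hXY, ← Matrix.mul_assoc P₁, ← Matrix.mul_assoc P₂, h₁, h₂]

end Structure

open Finset in
/-- The weighted count of matrices by number of nonzero entries. -/
lemma sum_pow_card_support {F α : Type*} [Field F] [Fintype F] [DecidableEq F] [Fintype α]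
    [DecidableEq α] (z : ℝ) :
    ∑ f : α → F, z ^ #{x | f x ≠ 0} = (1 + (Fintype.card F - 1) * z) ^ Fintype.card α := by
  have h : ∀ f : α → F, z ^ #{x | f x ≠ 0} = ∏ x, if f x = 0 then 1 else z := by
    intro f
    rw [prod_ite, prod_const_one, prod_const, one_mul]
  simp_rw [h]
  have h2 := (Finset.prod_univ_sum (fun _ : α => (univ : Finset F))
    (fun _ y => if y = 0 then (1 : ℝ) else z)).symm
  rw [Fintype.piFinset_univ] at h2
  rw [h2, prod_const, card_univ]
  congr 1
  rw [sum_ite, sum_const, sum_const, filter_eq' univ (0 : F), filter_ne' univ (0 : F)]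
  simp [card_erase_of_mem, Nat.cast_sub Fintype.card_pos]

section Deletion

open Finset

variable {ε κ : Type*} [Fintype ε] [DecidableEq ε] [Fintype κ] [DecidableEq κ]

/-- The expectation of `2 ^ (-|S ∩ R|)` on the event `U ⊆ R` for a `p`-random set `R`. -/
lemma sum_weight_le {p : ℝ} (hp0 : 0 ≤ p) (hp1 : p ≤ 1) (S U : Finset ε) :
    ∑ R : Finset ε, p ^ #R * (1 - p) ^ #Rᶜ * (if U ⊆ R then (1 / 2 : ℝ) ^ #(S ∩ R) else 0) ≤
      (2 * p) ^ #U * (1 - p / 2) ^ #S := by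
  have h1 : ∀ R : Finset ε,
      p ^ #R * (1 - p) ^ #Rᶜ * (if U ⊆ R then (1 / 2 : ℝ) ^ #(S ∩ R) else 0) =
      (∏ e ∈ R, p * if e ∈ S then 1 / 2 else 1) *
        ∏ e ∈ univ \ R, (1 - p) * if e ∈ U then 0 else 1 := by
    intro R
    rw [prod_mul_distrib, prod_mul_distrib, prod_const, prod_const, prod_ite, prod_const,
      prod_const_one, mul_one, ← compl_eq_univ_sdiff, filter_mem_eq_inter, inter_comm R S]
    have h2 : (∏ e ∈ Rᶜ, if e ∈ U then (0 : ℝ) else 1) = if U ⊆ R then 1 else 0 := by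
      split_ifs with h
      · refine prod_eq_one fun e he => if_neg fun heU => ?_
        exact (mem_compl.1 he) (h heU)
      · obtain ⟨e, heU, heR⟩ := not_subset.1 h
        exact prod_eq_zero (mem_compl.2 heR) (if_pos heU)
    rw [h2]
    split_ifs <;> ring
  have h3 := prod_add (fun e : ε => p * if e ∈ S then (1 / 2 : ℝ) else 1)
    (fun e => (1 - p) * if e ∈ U then (0 : ℝ) else 1) univ
  rw [powerset_univ] at h3
  simp_rw [h1]
  rw [← h3]
  have h4 : (2 * p) ^ #U * (1 - p / 2) ^ #S =
      ∏ e : ε, (if e ∈ U then 2 * p else 1) * (if e ∈ S then 1 - p / 2 else 1) := by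
    rw [prod_mul_distrib, prod_ite, prod_ite]
    simp
  rw [h4]
  refine prod_le_prod (fun e _ => ?_) fun e _ => ?_
  · have : 0 ≤ 1 - p := by linarith
    split_ifs <;> positivity
  · split_ifs <;> nlinarith

lemma sum_weight_eq_one (p : ℝ) : ∑ R : Finset ε, p ^ #R * (1 - p) ^ #Rᶜ = 1 := by
  have h := prod_add (fun _ : ε => p) (fun _ => 1 - p) univ
  rw [powerset_univ] at h
  simp only [prod_const, add_sub_cancel, one_pow, ← compl_eq_univ_sdiff] at h
  exact h.symm

/-- Deleting a maximal packing of the configurations `E c` from a random set leaves a set that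
contains no configuration, but still meets every set of a not too large family. -/
lemma exists_free_hitting {ι : Type*} (E : κ → Finset ε) (f : ℕ) (hf : 1 ≤ f)
    (hE : ∀ c, #(E c) = f) {p : ℝ} (hp0 : 0 ≤ p) (hp1 : p ≤ 1) (T : Finset ι) (S : ι → Finset ε)
    (hT : ∑ i ∈ T, Real.exp (-(p / 2 * #(S i)) + (4 * p) ^ f * #{c | ¬ Disjoint (E c) (S i)}) < 1) :
    ∃ R : Finset ε, (∀ c, ¬ E c ⊆ R) ∧ ∀ i ∈ T, ¬ Disjoint (S i) R := by
  classical
  have hpack : ∀ R : Finset ε, ∃ P : Finset κ, ((P : Set κ).PairwiseDisjoint E ∧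
      ∀ c ∈ P, E c ⊆ R) ∧ ∀ c, ¬ E c ⊆ R \ P.biUnion E := by
    intro R
    obtain ⟨P, hP⟩ := (univ.filter fun P : Finset κ => (P : Set κ).PairwiseDisjoint E ∧
      ∀ c ∈ P, E c ⊆ R).exists_maximal ⟨∅, by simp⟩
    have hP1 := (mem_filter.1 hP.prop).2
    refine ⟨P, hP1, fun c hc => ?_⟩
    have hdisj : ∀ d ∈ P, Disjoint (E c) (E d) := fun d hd =>
      disjoint_of_subset_left hc (disjoint_of_subset_right (subset_biUnion_of_mem E hd)
        sdiff_disjoint)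
    have hcP : c ∉ P := fun h => by
      have h0 := hdisj c h
      rw [disjoint_self_iff_empty] at h0
      have := hE c
      rw [h0, card_empty] at this
      omega
    have hins : insert c P ∈ univ.filter fun P : Finset κ => (P : Set κ).PairwiseDisjoint E ∧
        ∀ c ∈ P, E c ⊆ R := by
      refine mem_filter.2 ⟨mem_univ _, ?_, ?_⟩
      · rw [coe_insert]
        exact hP1.1.insert fun d hd _ => hdisj d hd
      · intro d hd
        rcases mem_insert.1 hd with rfl | hd
        · exact hc.trans sdiff_subset
        · exact hP1.2 d hd
    exact hcP (hP.le_of_ge hins (subset_insert _ _) (mem_insert_self _ _))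
  choose P hP hfree using hpack
  set C : ι → Finset κ := fun i => {c | ¬ Disjoint (E c) (S i)} with hC
  set D : ι → Finset (Finset κ) := fun i =>
    (C i).powerset.filter fun Q : Finset κ => (Q : Set κ).PairwiseDisjoint E with hD
  set wt : Finset ε → ℝ := fun R => p ^ #R * (1 - p) ^ #Rᶜ with hwt
  have hwt0 : ∀ R, 0 ≤ wt R := fun R => by
    have : 0 ≤ 1 - p := by linarith
    positivity
  by_contra! hcon
  have hbad : ∀ R : Finset ε, ∃ i ∈ T, Disjoint (S i) (R \ (P R).biUnion E) :=
    fun R => hcon _ (hfree R)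
  have hind : ∀ R : Finset ε, (1 : ℝ) ≤ ∑ i ∈ T,
      ∑ Q ∈ D i,
        (2 ^ f : ℝ) ^ #Q * (if Q.biUnion E ⊆ R then (1 / 2 : ℝ) ^ #(S i ∩ R) else 0) := by
    intro R
    obtain ⟨i, hi, hdis⟩ := hbad R
    refine le_trans ?_ (single_le_sum (f := fun i => ∑ Q ∈ D i, (2 ^ f : ℝ) ^ #Q *
        (if Q.biUnion E ⊆ R then (1 / 2 : ℝ) ^ #(S i ∩ R) else 0))
      (fun j _ => sum_nonneg fun Q _ => by split_ifs <;> positivity) hi)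
    set PS := P R ∩ C i with hPS
    have hsub : S i ∩ R ⊆ PS.biUnion E := by
      intro e he
      obtain ⟨heS, heR⟩ := mem_inter.1 he
      by_contra hne
      refine disjoint_left.1 hdis heS (mem_sdiff.2 ⟨heR, fun h => hne ?_⟩)
      obtain ⟨c, hcP, hec⟩ := mem_biUnion.1 h
      refine mem_biUnion.2 ⟨c, mem_inter.2 ⟨hcP, ?_⟩, hec⟩
      exact mem_filter.2 ⟨mem_univ _, fun hd => disjoint_left.1 hd hec heS⟩
    have hcard : #(S i ∩ R) ≤ #PS * f :=
      (card_le_card hsub).trans (card_biUnion_le_card_mul _ _ _ fun c _ => (hE c).le)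
    have h2 : ∑ Q ∈ PS.powerset, (2 ^ f : ℝ) ^ #Q * (1 / 2 : ℝ) ^ #(S i ∩ R) ≤
        ∑ Q ∈ D i,
        (2 ^ f : ℝ) ^ #Q * (if Q.biUnion E ⊆ R then (1 / 2 : ℝ) ^ #(S i ∩ R) else 0) := by
      have hle : ∀ Q ∈ PS.powerset, (2 ^ f : ℝ) ^ #Q * (1 / 2 : ℝ) ^ #(S i ∩ R) =
          (2 ^ f : ℝ) ^ #Q * (if Q.biUnion E ⊆ R then (1 / 2 : ℝ) ^ #(S i ∩ R) else 0) := by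
        intro Q hQ
        rw [if_pos]
        refine biUnion_subset.2 fun c hc => (hP R).2 c ?_
        exact (mem_inter.1 (mem_powerset.1 hQ hc)).1
      rw [sum_congr rfl hle]
      refine sum_le_sum_of_subset_of_nonneg (fun Q hQ => ?_) fun Q _ _ => by
        split_ifs <;> positivity
      have hQ := mem_powerset.1 hQ
      refine mem_filter.2 ⟨mem_powerset.2 (hQ.trans inter_subset_right), ?_⟩
      exact (hP R).1.subset (coe_subset.2 (hQ.trans inter_subset_left))
    refine le_trans ?_ h2
    rw [← sum_mul]
    have h3 : ∑ Q ∈ PS.powerset, (2 ^ f : ℝ) ^ #Q = (1 + 2 ^ f) ^ #PS := by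
      have := sum_pow_mul_eq_add_pow (2 ^ f : ℝ) 1 PS
      simpa [add_comm] using this
    rw [h3]
    have h4 : (2 : ℝ) ^ #(S i ∩ R) ≤ (1 + 2 ^ f) ^ #PS := by
      calc (2 : ℝ) ^ #(S i ∩ R) ≤ 2 ^ (#PS * f) := by gcongr; norm_num
        _ = (2 ^ f) ^ #PS := by rw [mul_comm, pow_mul]
        _ ≤ _ := by gcongr; linarith
    calc (1 : ℝ) = 2 ^ #(S i ∩ R) * (1 / 2) ^ #(S i ∩ R) := by rw [← mul_pow]; norm_num
      _ ≤ _ := by gcongr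
  have hexp : ∀ i ∈ T, ∑ R : Finset ε, wt R *
      ∑ Q ∈ D i,
        (2 ^ f : ℝ) ^ #Q * (if Q.biUnion E ⊆ R then (1 / 2 : ℝ) ^ #(S i ∩ R) else 0) ≤
      Real.exp (-(p / 2 * #(S i)) + (4 * p) ^ f * #(C i)) := by
    intro i _
    simp_rw [mul_sum]
    rw [sum_comm]
    calc _ ≤ ∑ Q ∈ D i,
          ((4 * p) ^ f) ^ #Q * (1 - p / 2) ^ #(S i) := by
          refine sum_le_sum fun Q hQ => ?_
          have hQd := (mem_filter.1 hQ).2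
          have hcard : #(Q.biUnion E) = f * #Q := by
            rw [card_biUnion (fun c hc d hd hcd => hQd hc hd hcd), sum_congr rfl fun c _ => hE c,
              sum_const, smul_eq_mul, mul_comm]
          calc _ = (2 ^ f : ℝ) ^ #Q * ∑ R : Finset ε, p ^ #R * (1 - p) ^ #Rᶜ *
                (if Q.biUnion E ⊆ R then (1 / 2 : ℝ) ^ #(S i ∩ R) else 0) := by
                rw [mul_sum]
                exact sum_congr rfl fun R _ => by rw [hwt]; ring
            _ ≤ (2 ^ f : ℝ) ^ #Q * ((2 * p) ^ #(Q.biUnion E) * (1 - p / 2) ^ #(S i)) := by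
                gcongr
                exact sum_weight_le hp0 hp1 _ _
            _ = _ := by
                rw [hcard, pow_mul, ← mul_assoc, ← mul_pow, ← mul_pow]
                ring_nf
      _ ≤ ∑ Q ∈ (C i).powerset, ((4 * p) ^ f) ^ #Q * (1 - p / 2) ^ #(S i) := by
          refine sum_le_sum_of_subset_of_nonneg (filter_subset _ _) fun Q _ _ => ?_
          have : 0 ≤ 1 - p / 2 := by linarith
          positivity
      _ = (1 + (4 * p) ^ f) ^ #(C i) * (1 - p / 2) ^ #(S i) := by
          rw [← sum_mul]
          have := sum_pow_mul_eq_add_pow ((4 * p) ^ f) 1 (C i)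
          rw [add_comm 1, ← this]
          simp
      _ ≤ Real.exp ((4 * p) ^ f) ^ #(C i) * Real.exp (-(p / 2)) ^ #(S i) := by
          have h0 : 0 ≤ 1 - p / 2 := by linarith
          gcongr
          · rw [add_comm]; exact Real.add_one_le_exp _
          · linarith [Real.add_one_le_exp (-(p / 2))]
      _ = _ := by
          rw [← Real.exp_nat_mul, ← Real.exp_nat_mul, ← Real.exp_add]
          ring_nf
  have : (1 : ℝ) < 1 := by
    calc (1 : ℝ) = ∑ R : Finset ε, wt R * 1 := by simp only [mul_one, hwt, sum_weight_eq_one]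
      _ ≤ ∑ R : Finset ε, wt R * ∑ i ∈ T,
          ∑ Q ∈ D i,
          (2 ^ f : ℝ) ^ #Q * (if Q.biUnion E ⊆ R then (1 / 2 : ℝ) ^ #(S i ∩ R) else 0) :=
          sum_le_sum fun R _ => mul_le_mul_of_nonneg_left (hind R) (hwt0 R)
      _ = ∑ i ∈ T, ∑ R : Finset ε, wt R *
          ∑ Q ∈ D i,
          (2 ^ f : ℝ) ^ #Q * (if Q.biUnion E ⊆ R then (1 / 2 : ℝ) ^ #(S i ∩ R) else 0) := by
          simp_rw [mul_sum (s := T)]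
          rw [sum_comm]
      _ ≤ _ := sum_le_sum hexp
      _ < 1 := hT
  exact lt_irrefl _ this

end Deletion

open Finset in
lemma card_maps_through_le {W : Type*} [Fintype W] [DecidableEq W] (n : ℕ) {u v : W} (huv : u ≠ v)
    (x y : Fin n) : #{φ : W → Fin n | φ u = x ∧ φ v = y} ≤ n ^ (Fintype.card W - 2) := by
  have hc : #((univ.erase u).erase v) = Fintype.card W - 2 := by
    rw [card_erase_of_mem (by simp [huv.symm]), card_erase_of_mem (mem_univ u), card_univ]
    omega
  calc #{φ : W → Fin n | φ u = x ∧ φ v = y}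
      ≤ #(univ : Finset (((univ.erase u).erase v : Finset W) → Fin n)) := by
        refine card_le_card_of_injOn (fun φ w => φ w) (fun _ _ => mem_coe.2 (mem_univ _)) ?_
        intro φ hφ ψ hψ h
        simp only [coe_filter, mem_univ, true_and, Set.mem_ofPred_eq] at hφ hψ
        ext1 w
        by_cases hu : w = u
        · rw [hu, hφ.1, hψ.1]
        by_cases hv : w = v
        · rw [hv, hφ.2, hψ.2]
        exact congrFun h ⟨w, by simp [hu, hv]⟩
    _ = n ^ (Fintype.card W - 2) := by
        rw [card_univ, Fintype.card_fun, Fintype.card_fin, Fintype.card_coe, hc]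

open Finset in
/-- The number of copies of `H` through a given edge. -/
lemma card_copies_through_le {W : Type*} [Fintype W] [DecidableEq W] (H : SimpleGraph W)
    [DecidableRel H.Adj] (n : ℕ) (e : Sym2 (Fin n)) :
    #{φ : W ↪ Fin n | e ∈ H.edgeFinset.image (Sym2.map φ)} ≤
      2 * #H.edgeFinset * n ^ (Fintype.card W - 2) := by
  induction e with | _ x y
  rw [← SimpleGraph.dart_card_eq_twice_card_edges, ← card_univ]
  have hsub : image (fun φ : W ↪ Fin n => (φ : W → Fin n))
      {φ : W ↪ Fin n | s(x, y) ∈ H.edgeFinset.image (Sym2.map φ)} ⊆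
      (univ : Finset H.Dart).biUnion fun d =>
        {φ : W → Fin n | φ d.fst = x ∧ φ d.snd = y} := by
    intro ψ hψ
    obtain ⟨φ, hφ, rfl⟩ := mem_image.1 hψ
    obtain ⟨e, he, hex⟩ := mem_image.1 (mem_filter.1 hφ).2
    induction e with | _ u v
    rw [SimpleGraph.mem_edgeFinset, SimpleGraph.mem_edgeSet] at he
    simp only [Sym2.map_mk, Sym2.eq_iff] at hex
    rcases hex with h | h
    · exact mem_biUnion.2 ⟨⟨(u, v), he⟩, mem_univ _, by simpa using h⟩
    · exact mem_biUnion.2 ⟨⟨(v, u), he.symm⟩, mem_univ _, by simpa using h.symm⟩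
  calc _ = #(image (fun φ : W ↪ Fin n => (φ : W → Fin n))
      {φ : W ↪ Fin n | s(x, y) ∈ H.edgeFinset.image (Sym2.map φ)}) :=
        (card_image_of_injective _ DFunLike.coe_injective).symm
    _ ≤ _ := card_le_card hsub
    _ ≤ _ := card_biUnion_le_card_mul _ _ _ fun d _ => card_maps_through_le n d.fst_ne_snd x y

open Finset in
lemma sum_pow_numNonzero {F V : Type*} [Field F] [Fintype F] [Fintype V]
    [DecidableEq V] [Fintype (Matrix V V F)] (z : ℝ) :
    ∑ X : Matrix V V F, z ^ numNonzero X =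
      (1 + (Fintype.card F - 1) * z) ^ (Fintype.card V ^ 2) := by
  classical
  rw [sq, ← Fintype.card_prod, ← sum_pow_card_support (F := F)]
  exact Fintype.sum_equiv ((Matrix.of (α := F)).symm.trans (Equiv.curry V V F).symm) _ _
    fun X => rfl

open Finset in
/-- The union bound over all matrices that are encoded by their row and column bases. -/
lemma sum_exp_bases_lt_one {F V : Type*} [Field F] [Fintype F] [Fintype V] [DecidableEq V]
    (hV : 2 ≤ Fintype.card V) (T : Finset (Matrix V V F)) (I J : Matrix V V F → Finset V)
    (hI : ∀ N ∈ T, ∃ P, N = P * (coordProj F (I N) * N))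
    (hJ : ∀ N ∈ T, ∃ Q, N = N * coordProj F (J N) * Q)
    (hpos : ∀ N ∈ T, 1 ≤ numNonzero (coordProj F (I N) * N)) :
    ∑ N ∈ T, Real.exp (-(3 * Real.log ((Fintype.card V : ℝ) * Fintype.card F) *
      (numNonzero (coordProj F (I N) * N) + numNonzero (N * coordProj F (J N))))) < 1 := by
  classical
  set n : ℝ := (Fintype.card V : ℝ) with hn
  set q : ℝ := (Fintype.card F : ℝ) with hq
  have hn2 : 2 ≤ n := by rw [hn]; exact_mod_cast hV
  have hq2 : 2 ≤ q := by rw [hq]; exact_mod_cast Fintype.one_lt_card (α := F)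
  have hnq : 0 < n * q := by positivity
  set z : ℝ := ((n * q) ^ 2)⁻¹ with hz
  have hz0 : 0 ≤ z := by positivity
  set c : Matrix V V F → Matrix V V F × Matrix V V F := fun N =>
    (coordProj F (I N) * N, N * coordProj F (J N)) with hc
  have hinj : Set.InjOn c T := by
    intro N₁ h₁ N₂ h₂ h
    obtain ⟨P₁, hP₁⟩ := hI N₁ h₁
    obtain ⟨P₂, hP₂⟩ := hI N₂ h₂
    obtain ⟨Q₁, hQ₁⟩ := hJ N₁ h₁
    have hX : coordProj F (I N₁) * N₁ = coordProj F (I N₂) * N₂ := congrArg Prod.fst h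
    have hY : N₁ * coordProj F (J N₁) = N₂ * coordProj F (J N₂) := congrArg Prod.snd h
    exact eq_of_bases_eq rfl rfl hY hP₁ (hX ▸ hP₂) hQ₁
  have hterm : ∀ N ∈ T, Real.exp (-(3 * Real.log (n * q) *
      (numNonzero (coordProj F (I N) * N) + numNonzero (N * coordProj F (J N))))) ≤
      1 / 4 * (z ^ numNonzero (c N).1 * z ^ numNonzero (c N).2) := by
    intro N hN
    have h1 := hpos N hN
    rw [← pow_add]
    simp only [hc]
    obtain ⟨m, hm⟩ : ∃ m, numNonzero (coordProj F (I N) * N) +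
      numNonzero (N * coordProj F (J N)) = m := ⟨_, rfl⟩
    have hm1 : 1 ≤ m := by omega
    rw [← Nat.cast_add, hm]
    have h2 : Real.exp (-(3 * Real.log (n * q) * m)) = ((n * q)⁻¹) ^ m * z ^ m := by
      rw [show -(3 * Real.log (n * q) * m) = ((3 * m : ℕ) : ℝ) * -Real.log (n * q) by
        push_cast; ring, Real.exp_nat_mul, Real.exp_neg, Real.exp_log hnq, ← mul_pow, pow_mul, hz]
      congr 1
      field_simp
    rw [h2]
    gcongr
    have h4 : (n * q)⁻¹ ≤ 1 / 4 := by
      rw [inv_eq_one_div]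
      exact one_div_le_one_div_of_le (by norm_num) (by nlinarith)
    calc ((n * q)⁻¹) ^ m ≤ ((n * q)⁻¹) ^ 1 :=
          pow_le_pow_of_le_one (by positivity) (by linarith) hm1
      _ ≤ 1 / 4 := by simpa using h4
  have hsum : ∑ X : Matrix V V F, z ^ numNonzero X ≤ Real.exp (1 / 2) := by
    rw [sum_pow_numNonzero]
    have h1 : 1 + (q - 1) * z ≤ Real.exp ((q - 1) * z) := by
      linarith [Real.add_one_le_exp ((q - 1) * z)]
    calc (1 + (q - 1) * z) ^ (Fintype.card V ^ 2)
        ≤ Real.exp ((q - 1) * z) ^ (Fintype.card V ^ 2) := by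
          have : 0 ≤ (q - 1) * z := mul_nonneg (by linarith) hz0
          gcongr
      _ = Real.exp ((q - 1) / q ^ 2) := by
          rw [← Real.exp_nat_mul]
          congr 1
          push_cast
          rw [← hn, hz]
          field_simp
      _ ≤ Real.exp (1 / 2) := by
          refine Real.exp_le_exp.2 ?_
          rw [div_le_iff₀ (by positivity)]
          nlinarith
  calc _ ≤ ∑ N ∈ T, 1 / 4 * (z ^ numNonzero (c N).1 * z ^ numNonzero (c N).2) :=
        sum_le_sum hterm
    _ = ∑ x ∈ T.image c, 1 / 4 * (z ^ numNonzero x.1 * z ^ numNonzero x.2) := by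
        rw [sum_image hinj]
    _ ≤ ∑ x : Matrix V V F × Matrix V V F,
        1 / 4 * (z ^ numNonzero x.1 * z ^ numNonzero x.2) :=
        sum_le_sum_of_subset_of_nonneg (subset_univ _) fun x _ _ => by positivity
    _ = 1 / 4 * ((∑ X : Matrix V V F, z ^ numNonzero X) *
        ∑ X : Matrix V V F, z ^ numNonzero X) := by
        rw [← mul_sum, sum_mul_sum, Fintype.sum_prod_type]
    _ ≤ 1 / 4 * (Real.exp (1 / 2) * Real.exp (1 / 2)) := by
        have h0 : 0 ≤ ∑ X : Matrix V V F, z ^ numNonzero X :=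
          sum_nonneg fun X _ => by positivity
        gcongr
    _ < 1 := by
        rw [← Real.exp_add]
        norm_num
        linarith [Real.exp_one_lt_d9]

open Finset in
/-- The graph of the off-diagonal nonzero entries of a matrix. -/
noncomputable def offDiagSupport {F V : Type*} [Field F] [Fintype V] (N : Matrix V V F) :
    Finset (Sym2 V) := by
  classical exact
    (univ.filter fun x : V × V => x.1 ≠ x.2 ∧ N x.1 x.2 ≠ 0).image fun x => s(x.1, x.2)

lemma mem_offDiagSupport {F V : Type*} [Field F] [Fintype V] {N : Matrix V V F} {e : Sym2 V} :
    e ∈ offDiagSupport N ↔ ∃ i j, i ≠ j ∧ N i j ≠ 0 ∧ s(i, j) = e := by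
  classical
  unfold offDiagSupport
  simp [and_assoc]

open Finset in
lemma numNonzero_le_add_offDiagSupport {F V : Type*} [Field F] [Fintype V]
    (N : Matrix V V F) (A : Finset V) (hA : ∀ v, N v v ≠ 0 → v ∈ A) :
    numNonzero N ≤ #A + 2 * #(offDiagSupport N) := by
  classical
  have hsub : (univ.filter fun x : V × V => N x.1 x.2 ≠ 0) ⊆
      A.image (fun a => (a, a)) ∪ univ.filter fun x : V × V => x.1 ≠ x.2 ∧ N x.1 x.2 ≠ 0 := by
    rintro ⟨i, j⟩ hx
    have hx : N i j ≠ 0 := (mem_filter.1 hx).2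
    by_cases hij : i = j
    · subst hij
      exact mem_union_left _ (mem_image.2 ⟨i, hA i hx, rfl⟩)
    · exact mem_union_right _ (mem_filter.2 ⟨mem_univ _, hij, hx⟩)
  have hoff : #(univ.filter fun x : V × V => x.1 ≠ x.2 ∧ N x.1 x.2 ≠ 0) ≤
      2 * #(offDiagSupport N) := by
    refine card_le_mul_card_image _ 2 fun e _ => ?_
    induction e with | _ a b
    refine (card_le_card (t := {(a, b), (b, a)}) ?_).trans card_le_two
    rintro ⟨i, j⟩ hx
    have := (mem_filter.1 hx).2
    rw [Sym2.eq_iff] at this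
    simpa [Prod.ext_iff] using this
  calc numNonzero N = #(univ.filter fun x : V × V => N x.1 x.2 ≠ 0) := by
        unfold numNonzero; congr!
    _ ≤ _ := (card_le_card hsub).trans (card_union_le _ _)
    _ ≤ _ := add_le_add card_image_le hoff

open Finset in
/-- Bounding the expected number of copies of `H` meeting a given set of edges. -/
lemma card_copies_meeting_le {W : Type*} [Fintype W] [DecidableEq W] (H : SimpleGraph W)
    [DecidableRel H.Adj] (n : ℕ) (S : Finset (Sym2 (Fin n))) :
    #{φ : W ↪ Fin n | ¬ Disjoint (H.edgeFinset.image (Sym2.map φ)) S} ≤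
      #S * (2 * #H.edgeFinset * n ^ (Fintype.card W - 2)) := by
  have hsub : (univ.filter fun φ : W ↪ Fin n =>
      ¬ Disjoint (H.edgeFinset.image (Sym2.map φ)) S) ⊆
      S.biUnion fun e => {φ : W ↪ Fin n | e ∈ H.edgeFinset.image (Sym2.map φ)} := by
    intro φ hφ
    obtain ⟨e, he, heS⟩ := not_disjoint_iff.1 (mem_filter.1 hφ).2
    exact mem_biUnion.2 ⟨e, heS, mem_filter.2 ⟨mem_univ _, he⟩⟩
  exact (card_le_card hsub).trans (card_biUnion_le_card_mul _ _ _ fun e _ =>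
    card_copies_through_le H n e)

open Finset in
theorem exists_compl_free_minrk_ge {W : Type*} [Fintype W] [DecidableEq W] (H : SimpleGraph W)
    [DecidableRel H.Adj] (hf : 2 ≤ #H.edgeFinset) :
    ∃ c : ℝ, 0 < c ∧ ∀ n : ℕ, 2 ≤ n → ∀ (F : Type) [Field F] [Fintype F],
      ∃ G : SimpleGraph (Fin n), ¬ ContainsCopy H Gᶜ ∧
        c * (n : ℝ) ^ (1 - ((Fintype.card W : ℝ) - 2) / (#H.edgeFinset - 1)) /
          Real.log ((n : ℝ) * (Fintype.card F : ℝ)) ≤ (minrk F G : ℝ) := by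
  classical
  set f := #H.edgeFinset with hfdef
  have hW : 2 ≤ Fintype.card W := by
    obtain ⟨e, he⟩ := card_pos.1 (show 0 < #H.edgeFinset by omega)
    induction e with | _ u v
    rw [SimpleGraph.mem_edgeFinset, SimpleGraph.mem_edgeSet] at he
    exact Fintype.one_lt_card_iff.2 ⟨u, v, he.ne⟩
  set γ : ℝ := ((Fintype.card W : ℝ) - 2) / (f - 1) with hγ
  have hfR : (2 : ℝ) ≤ f := by exact_mod_cast hf
  have hWR : (2 : ℝ) ≤ Fintype.card W := by exact_mod_cast hW
  have hγ0 : 0 ≤ γ := div_nonneg (by linarith) (by linarith)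
  set c₀ : ℝ := 1 / (8 * f * 4 ^ f) with hc₀
  have hc₀0 : 0 < c₀ := by positivity
  have hc₀1 : c₀ ≤ 1 := by
    rw [hc₀, div_le_one (by positivity)]
    have : (1 : ℝ) ≤ 4 ^ f := one_le_pow₀ (by norm_num)
    nlinarith
  refine ⟨c₀ / 96, by positivity, fun n hn F _ _ => ?_⟩
  have : Nonempty (Fin n) := ⟨⟨0, by omega⟩⟩
  have hnR : (2 : ℝ) ≤ n := by exact_mod_cast hn
  have hn0 : (0 : ℝ) < n := by linarith
  have hqR : (2 : ℝ) ≤ Fintype.card F := by exact_mod_cast Fintype.one_lt_card (α := F)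
  set L := Real.log ((n : ℝ) * (Fintype.card F : ℝ)) with hL
  have hL1 : 1 ≤ L := by
    rw [hL, Real.le_log_iff_exp_le (by positivity)]
    nlinarith [Real.exp_one_lt_d9]
  set p : ℝ := c₀ * (n : ℝ) ^ (-γ) with hp
  have hp0 : 0 < p := by positivity
  have hp1 : p ≤ 1 := by
    have : (n : ℝ) ^ (-γ) ≤ 1 := Real.rpow_le_one_of_one_le_of_nonpos (by linarith) (by linarith)
    nlinarith
  have hpn : (c₀ / 96) * (n : ℝ) ^ (1 - γ) = p * n / 96 := by
    rw [sub_eq_add_neg, Real.rpow_add hn0, Real.rpow_one, hp]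
    ring
  have hpf : p ^ (f - 1) * (n : ℝ) ^ (Fintype.card W - 2) ≤ c₀ := by
    have h1 : ((n : ℝ) ^ (-γ)) ^ (f - 1) * (n : ℝ) ^ (Fintype.card W - 2) = 1 := by
      rw [← Real.rpow_natCast, ← Real.rpow_mul hn0.le, ← Real.rpow_natCast, ← Real.rpow_add hn0]
      have : (f : ℝ) - 1 ≠ 0 := by linarith
      rw [Nat.cast_sub (by omega), Nat.cast_sub hW, hγ]
      push_cast
      rw [neg_mul, div_mul_cancel₀ _ this, neg_add_cancel, Real.rpow_zero]
    rw [hp, mul_pow, mul_assoc, h1, mul_one]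
    exact pow_le_of_le_one hc₀0.le hc₀1 (by omega)
  have hcopies : ∀ S : Finset (Sym2 (Fin n)), (4 * p) ^ f *
      #{φ : W ↪ Fin n | ¬ Disjoint (H.edgeFinset.image (Sym2.map φ)) S} ≤ p / 4 * #S := by
    intro S
    have h1 : (#{φ : W ↪ Fin n | ¬ Disjoint (H.edgeFinset.image (Sym2.map φ)) S} : ℝ) ≤
        #S * (2 * f * (n : ℝ) ^ (Fintype.card W - 2)) := by
      exact_mod_cast card_copies_meeting_le H n S
    calc _ ≤ (4 * p) ^ f * (#S * (2 * f * (n : ℝ) ^ (Fintype.card W - 2))) := by gcongr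
      _ = 4 ^ f * 2 * f * #S * p * (p ^ (f - 1) * (n : ℝ) ^ (Fintype.card W - 2)) := by
          rw [mul_pow, ← mul_pow_sub_one (by omega : f ≠ 0) p]
          ring
      _ ≤ 4 ^ f * 2 * f * #S * p * c₀ := by gcongr
      _ = p / 4 * #S := by
          rw [hc₀]
          field_simp
          ring
  set Code : Matrix (Fin n) (Fin n) F → Finset (Fin n) → Finset (Fin n) → Prop := fun N I J =>
    (∃ P, N = P * (coordProj F I * N)) ∧ (∃ Q, N = N * coordProj F J * Q) ∧
    1 ≤ numNonzero (coordProj F I * N) ∧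
    3 * L * (numNonzero (coordProj F I * N) + numNonzero (N * coordProj F J)) ≤
      p / 4 * #(offDiagSupport N) with hCode
  obtain ⟨T, hT⟩ : ∃ T : Finset (Matrix (Fin n) (Fin n) F), ∀ N, N ∈ T ↔ ∃ I J, Code N I J :=
    ⟨univ.filter fun N => ∃ I J, Code N I J, by simp⟩
  have hex : ∀ N, ∃ I J, N ∈ T → Code N I J := fun N => by
    by_cases h : N ∈ T
    · obtain ⟨I, J, hIJ⟩ := (hT N).1 h
      exact ⟨I, J, fun _ => hIJ⟩
    · exact ⟨∅, ∅, fun h' => absurd h' h⟩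
  choose I J hIJ using hex
  have hbound := sum_exp_bases_lt_one (F := F) (V := Fin n) (by simpa using hn) T I J
    (fun N hN => (hIJ N hN).1) (fun N hN => (hIJ N hN).2.1) fun N hN => (hIJ N hN).2.2.1
  rw [Fintype.card_fin, ← hL] at hbound
  obtain ⟨R, hRfree, hRhit⟩ := exists_free_hitting
    (fun φ : W ↪ Fin n => H.edgeFinset.image (Sym2.map φ)) f (by omega)
    (fun φ => card_image_of_injective _ (Sym2.map.injective φ.injective)) hp0.le hp1 T
    offDiagSupport (lt_of_le_of_lt (sum_le_sum fun N hN => by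
      refine Real.exp_le_exp.2 ?_
      have h1 := hcopies (offDiagSupport N)
      have h2 := (hIJ N hN).2.2.2
      linarith) hbound)
  refine ⟨(SimpleGraph.fromEdgeSet (R : Set (Sym2 (Fin n))))ᶜ, ?_, ?_⟩
  · rw [compl_compl]
    rintro ⟨φ, hφ, hadj⟩
    refine hRfree ⟨φ, hφ⟩ fun e he => ?_
    obtain ⟨d, hd, rfl⟩ := mem_image.1 he
    induction d with | _ u v
    rw [SimpleGraph.mem_edgeFinset, SimpleGraph.mem_edgeSet] at hd
    exact ((SimpleGraph.fromEdgeSet_adj _).1 (hadj u v hd)).1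
  · set G := (SimpleGraph.fromEdgeSet (R : Set (Sym2 (Fin n))))ᶜ with hG
    obtain ⟨M, ⟨hM, hM0⟩, hrank⟩ : ∃ M : Matrix (Fin n) (Fin n) F, Represents M G ∧
        M.rank = minrk F G := by
      refine Nat.sInf_mem (s := { r : ℕ | ∃ M : Matrix (Fin n) (Fin n) F,
        Represents M G ∧ M.rank = r }) ⟨_, 1, ⟨fun v => by simp, fun u v huv _ => ?_⟩, rfl⟩
      exact Matrix.one_apply_ne huv
    rw [← hrank, hpn]
    by_contra! hlt
    obtain ⟨A, I', J', N, hA, hN, hP, hQ, hX, hY, hAX⟩ := exists_sparse_bases M hM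
    have hNM : ∀ i j, N i j ≠ 0 → i ∈ A ∧ M i j ≠ 0 := by
      intro i j h
      rw [hN, mul_coordProj_apply, coordProj_mul_apply] at h
      split_ifs at h with h1 h2
      · exact ⟨h2, h⟩
      · exact absurd rfl h
      · exact absurd rfl h
    have hs := numNonzero_le_add_offDiagSupport N A fun v hv => (hNM v v hv).1
    have hNT : N ∈ T := by
      refine (hT N).2 ⟨I', J', hP, hQ, (card_pos.2 hA).trans_le hAX, ?_⟩
      rw [Fintype.card_fin] at hX hY
      set α : ℝ := M.rank / n with hα
      have hα0 : 0 ≤ α := by positivity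
      have hα1 : α * (96 * L) ≤ p := by
        rw [lt_div_iff₀ (by linarith)] at hlt
        rw [hα, div_mul_eq_mul_div, div_le_iff₀ hn0]
        linarith
      have hα2 : α ≤ 1 / 2 := by nlinarith
      have hs' : (numNonzero N : ℝ) ≤ #A + 2 * #(offDiagSupport N) := by exact_mod_cast hs
      have hAX' : (#A : ℝ) ≤ numNonzero (coordProj F I' * N) := by exact_mod_cast hAX
      have hNs : (numNonzero N : ℝ) ≤ 4 * #(offDiagSupport N) := by
        have : α * numNonzero N ≤ 1 / 2 * numNonzero N := by gcongr
        linarith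
      calc 3 * L * (numNonzero (coordProj F I' * N) + numNonzero (N * coordProj F J') : ℝ)
          ≤ 3 * L * (α * numNonzero N + α * numNonzero N) := by gcongr
        _ ≤ 3 * L * (α * (4 * #(offDiagSupport N)) + α * (4 * #(offDiagSupport N))) := by
            gcongr
        _ = (α * (96 * L)) / 4 * #(offDiagSupport N) := by ring
        _ ≤ p / 4 * #(offDiagSupport N) :=
            mul_le_mul_of_nonneg_right (by linarith) (Nat.cast_nonneg _)
    obtain ⟨e, he, heR⟩ := not_disjoint_iff.1 (hRhit N hNT)
    obtain ⟨i, j, hne, hNij, rfl⟩ := mem_offDiagSupport.1 he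
    refine (hNM i j hNij).2 (hM0 i j hne fun hadj => ?_)
    rw [hG, SimpleGraph.compl_adj, SimpleGraph.fromEdgeSet_adj] at hadj
    exact hadj.2 ⟨heR, hne⟩

/-- For a graph H with at least 3 edges, there is c > 0 (depending only on H)
such that for every n ≥ 2 and finite field F there is an n-vertex graph G whose complement is
H-free with minrk_F(G) ≥ c · n^{1-γ₀(H)} / log(n·|F|). -/
theorem exists_compl_free_minrk_ge_gamma0 {h : ℕ} (H : SimpleGraph (Fin h))
    (hf : 3 ≤ H.edgeSet.ncard) :
    ∃ c : ℝ, 0 < c ∧ ∀ n : ℕ, 2 ≤ n → ∀ (F : Type) [Field F] [Fintype F],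
      ∃ G : SimpleGraph (Fin n), ¬ ContainsCopy H Gᶜ ∧
        c * (n : ℝ) ^ (1 - gamma0 H) /
          Real.log ((n : ℝ) * (Fintype.card F : ℝ)) ≤ (minrk F G : ℝ) := by
  classical
  have hne : { x : ℝ | ∃ H' : SimpleGraph.Subgraph H, 3 ≤ H'.edgeSet.ncard ∧
      x = ((H'.verts.ncard : ℝ) - 2) / ((H'.edgeSet.ncard : ℝ) - 1) }.Nonempty :=
    ⟨_, ⊤, by simpa using hf, rfl⟩
  have hfin : { x : ℝ | ∃ H' : SimpleGraph.Subgraph H, 3 ≤ H'.edgeSet.ncard ∧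
      x = ((H'.verts.ncard : ℝ) - 2) / ((H'.edgeSet.ncard : ℝ) - 1) }.Finite :=
    (Set.finite_range fun H' : SimpleGraph.Subgraph H =>
      ((H'.verts.ncard : ℝ) - 2) / ((H'.edgeSet.ncard : ℝ) - 1)).subset fun x hx => by
        obtain ⟨H', -, rfl⟩ := hx
        exact ⟨H', rfl⟩
  obtain ⟨H', hH', hγ⟩ : ∃ H' : SimpleGraph.Subgraph H, 3 ≤ H'.edgeSet.ncard ∧
      gamma0 H = ((H'.verts.ncard : ℝ) - 2) / ((H'.edgeSet.ncard : ℝ) - 1) :=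
    hne.csInf_mem hfin
  have hedges : H'.coe.edgeFinset.card = H'.edgeSet.ncard := by
    rw [← SimpleGraph.Subgraph.image_coe_edgeSet_coe,
      Set.ncard_image_of_injective _ (Sym2.map.injective Subtype.val_injective),
      ← SimpleGraph.coe_edgeFinset, Set.ncard_coe_finset]
  have hverts : Fintype.card H'.verts = H'.verts.ncard := by
    rw [← Nat.card_eq_fintype_card, Nat.card_coe_set_eq]
  obtain ⟨c, hc, hcn⟩ := exists_compl_free_minrk_ge H'.coe (by omega)
  refine ⟨c, hc, fun n hn F _ _ => ?_⟩
  obtain ⟨G, hG, hrk⟩ := hcn n hn F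
  refine ⟨G, fun ⟨φ, hφ, hadj⟩ => hG ⟨fun v => φ v, hφ.comp Subtype.val_injective,
    fun a b hab => hadj _ _ (H'.adj_sub hab)⟩, ?_⟩
  rwa [hedges, hverts, ← hγ] at hrk
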